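/- arXiv:math/0603331 — 6 statements merged into one kernel-verified Lean document; each statement's English description precedes it below -/
import Mathlib

section
/- Let κ ≥ 2 be an integer, φ ≥ 0, and let u_1, …, u_κ be real numbers satisfying (Ei): (i−1)φ u_{i−1} − i(1+φ) u_i + (i+1) u_{i+1} = 0 for every 2 ≤ i ≤ κ−1, and (Eκ): (κ−1)φ u_{κ−1} − κ u_κ = 0. Then i·u_i = (i−1)φ·u_{i−1} for every 2 ≤ i ≤ κ. -/
/-- Mean-field stationarity of the IRP: the interior equations (Ei), 2 ≤ i ≤ κ−1,
together with (Eκ) imply the one-step relation `i·u_i = (i−1)·φ·u_{i−1}` for 2 ≤ i ≤ κ. -/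
theorem irp_mean_field_one_step (κ : ℕ) (hκ : 2 ≤ κ) (φ : ℝ) (hφ : 0 ≤ φ) (u : ℕ → ℝ)
    (hEi : ∀ i, 2 ≤ i → i ≤ κ - 1 →
      ((i : ℝ) - 1) * φ * u (i - 1) - (i : ℝ) * (1 + φ) * u i + ((i : ℝ) + 1) * u (i + 1) = 0)
    (hEκ : ((κ : ℝ) - 1) * φ * u (κ - 1) - (κ : ℝ) * u κ = 0) :
    ∀ i, 2 ≤ i → i ≤ κ → (i : ℝ) * u i = ((i : ℝ) - 1) * φ * u (i - 1) := by
  have key : ∀ d i, κ = i + d → 2 ≤ i →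
      (i : ℝ) * u i = ((i : ℝ) - 1) * φ * u (i - 1) := by
    intro d
    induction d with
    | zero =>
      intro i h _
      have h' : κ = i := by omega
      rw [h'] at hEκ
      linarith
    | succ d ih =>
      intro i h hi
      have h1 := ih (i + 1) (by omega) (by omega)
      have h2 := hEi i hi (by omega)
      rw [Nat.add_sub_cancel] at h1
      push_cast at h1
      linear_combination h1 - h2
  intro i hi hle
  exact key (κ - i) i (by omega) hi
end

section
/- Let κ ≥ 2 be an integer, φ ≥ 0, and let u_1, …, u_κ be real numbers satisfying (Ei): (i−1)φ u_{i−1} − i(1+φ) u_i + (i+1) u_{i+1} = 0 for every 2 ≤ i ≤ κ−1, and (Eκ): (κ−1)φ u_{κ−1} − κ u_κ = 0. Then u_i = (φ^{i−1}/i)·u_1 for every 1 ≤ i ≤ κ. -/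
/-- Mean-field stationarity of the IRP: the interior equations (Ei), 2 ≤ i ≤ κ−1,
together with (Eκ) imply `u_i = (φ^{i−1}/i)·u_1` for every 1 ≤ i ≤ κ. -/
theorem irp_mean_field_solution (κ : ℕ) (hκ : 2 ≤ κ) (φ : ℝ) (hφ : 0 ≤ φ) (u : ℕ → ℝ)
    (hEi : ∀ i, 2 ≤ i → i ≤ κ - 1 →
      ((i : ℝ) - 1) * φ * u (i - 1) - (i : ℝ) * (1 + φ) * u i + ((i : ℝ) + 1) * u (i + 1) = 0)
    (hEκ : ((κ : ℝ) - 1) * φ * u (κ - 1) - (κ : ℝ) * u κ = 0) :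
    ∀ i, 1 ≤ i → i ≤ κ → u i = φ ^ (i - 1) / (i : ℝ) * u 1 := by
  obtain ⟨m, rfl⟩ : ∃ m, κ = m + 2 := ⟨κ - 2, by omega⟩
  have hD : ∀ k j : ℕ, j + k = m →
      ((j : ℝ) + 1) * φ * u (j + 1) = ((j : ℝ) + 2) * u (j + 2) := by
    intro k
    induction k with
    | zero =>
      intro j hj
      obtain rfl : j = m := by omega
      have e : j + 2 - 1 = j + 1 := by omega
      rw [e] at hEκ
      push_cast at hEκ
      linarith
    | succ k ih =>
      intro j hj
      have h1 := ih (j + 1) (by omega)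
      have h2 := hEi (j + 2) (by omega) (by omega)
      have e : j + 2 - 1 = j + 1 := by omega
      have e1 : j + 1 + 1 = j + 2 := by omega
      have e2 : j + 1 + 2 = j + 3 := by omega
      have e3 : j + 2 + 1 = j + 3 := by omega
      rw [e, e3] at h2
      rw [e1, e2] at h1
      push_cast at h1 h2
      linarith
  have key : ∀ j : ℕ, j ≤ m + 1 → u (j + 1) = φ ^ j / ((j : ℝ) + 1) * u 1 := by
    intro j
    induction j with
    | zero => intro _; simp
    | succ j ih =>
      intro hj
      have h1 := ih (by omega)
      have h2 := hD (m - j) j (by omega)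
      have p1 : (j : ℝ) + 1 ≠ 0 := by positivity
      have p2 : (j : ℝ) + 2 ≠ 0 := by positivity
      have h3 : ((j : ℝ) + 1) * φ * u (j + 1) = φ ^ (j + 1) * u 1 := by
        rw [h1]; field_simp; ring
      have e : ((j + 1 : ℕ) : ℝ) + 1 = (j : ℝ) + 2 := by push_cast; ring
      have e1 : j + 1 + 1 = j + 2 := by omega
      rw [e, e1, div_mul_eq_mul_div, eq_div_iff p2]
      linarith
  intro i h1 h2
  obtain ⟨j, rfl⟩ : ∃ j, i = j + 1 := ⟨i - 1, by omega⟩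
  have := key j (by omega)
  simpa using this
end

section
/- Let κ ≥ 2 be an integer, λ > 0, φ ≥ 0, and let u_0, u_1, …, u_κ be real numbers with u_1 ≠ 0 satisfying (E0): u_1 − λ u_0 ∑_{i=1}^κ i u_i = 0, together with (Ei): (i−1)φ u_{i−1} − i(1+φ) u_i + (i+1) u_{i+1} = 0 for every 2 ≤ i ≤ κ−1 and (Eκ): (κ−1)φ u_{κ−1} − κ u_κ = 0. Then λ u_0 ∑_{i=0}^{κ−1} φ^i = 1; in particular u_0 = (λ (1 + φ + ⋯ + φ^{κ−1}))^{−1}. -/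
/-- Mean-field stationarity of the IRP: if `u_1 ≠ 0` then equation (E0) together with (Ei)
and (Eκ) forces `λ u_0 (1 + φ + ⋯ + φ^{κ−1}) = 1`, hence `u_0 = (λ (1 + ⋯ + φ^{κ−1}))⁻¹`. -/
theorem irp_mean_field_u0 (κ : ℕ) (hκ : 2 ≤ κ) (lam φ : ℝ) (hlam : 0 < lam) (hφ : 0 ≤ φ)
    (u : ℕ → ℝ) (hu1 : u 1 ≠ 0)
    (hE0 : u 1 - lam * u 0 * ∑ i ∈ Finset.Icc 1 κ, (i : ℝ) * u i = 0)
    (hEi : ∀ i, 2 ≤ i → i ≤ κ - 1 →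
      ((i : ℝ) - 1) * φ * u (i - 1) - (i : ℝ) * (1 + φ) * u i + ((i : ℝ) + 1) * u (i + 1) = 0)
    (hEκ : ((κ : ℝ) - 1) * φ * u (κ - 1) - (κ : ℝ) * u κ = 0) :
    lam * u 0 * ∑ i ∈ Finset.range κ, φ ^ i = 1 ∧
      u 0 = (lam * ∑ i ∈ Finset.range κ, φ ^ i)⁻¹ := by
  have hstep : ∀ j k : ℕ, k + j + 1 = κ → 1 ≤ k →
      ((k : ℝ) + 1) * u (k + 1) = φ * ((k : ℝ) * u k) := by
    intro j
    induction j with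
    | zero =>
      intro k hk h1
      subst hk
      simp only [Nat.add_zero, Nat.add_sub_cancel] at hEκ
      push_cast at hEκ
      linarith
    | succ j ih =>
      intro k hk h1
      have h := ih (k + 1) (by omega) (by omega)
      have e := hEi (k + 1) (by omega) (by omega)
      simp only [Nat.add_sub_cancel] at e
      push_cast at e h
      linarith
  have hv : ∀ i : ℕ, i + 1 ≤ κ → ((i : ℝ) + 1) * u (i + 1) = φ ^ i * u 1 := by
    intro i
    induction i with
    | zero => intro _; simp
    | succ i ih =>
      intro hi
      have h := hstep (κ - (i + 1) - 1) (i + 1) (by omega) (by omega)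
      have h2 := ih (by omega)
      push_cast at h ⊢
      rw [h, h2]
      ring
  have hsum : ∑ i ∈ Finset.Icc 1 κ, (i : ℝ) * u i = (∑ i ∈ Finset.range κ, φ ^ i) * u 1 := by
    rw [Finset.sum_mul, ← Finset.Ico_add_one_right_eq_Icc, Finset.sum_Ico_eq_sum_range]
    apply Finset.sum_congr (by simp)
    intro i hi
    have hi' : i < κ := by simpa using hi
    rw [← hv i hi', add_comm 1 i]
    push_cast
    ring
  rw [hsum] at hE0
  have key : lam * u 0 * ∑ i ∈ Finset.range κ, φ ^ i = 1 := by
    apply mul_right_cancel₀ hu1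
    linarith
  refine ⟨key, eq_inv_of_mul_eq_one_left ?_⟩
  linarith
end

section
/- Let κ ≥ 2 be an integer, λ > 0 and φ ≥ 0. There exist nonnegative real numbers u_0, u_1, …, u_κ with ∑_{i=0}^κ u_i = 1, with u_j > 0 for some 1 ≤ j ≤ κ, and satisfying all the mean-field stationarity equations (E0), (E1), (Ei) for 2 ≤ i ≤ κ−1 and (Eκ), if and only if λ (1 + φ + ⋯ + φ^{κ−1}) > 1. -/
theorem irp_sum_shift (f : ℕ → ℝ) (n : ℕ) :
    ∑ i ∈ Finset.Icc 1 n, f i = ∑ i ∈ Finset.range n, f (i + 1) := by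
  induction n with
  | zero => simp
  | succ k ih => rw [Finset.sum_Icc_succ_top (by omega), ih, Finset.sum_range_succ]

/-- The mean-field model of the IRP admits a nontrivial stationary solution (nonnegative
densities summing to one, with some infected density positive, satisfying (E0), (E1),
(Ei) for 2 ≤ i ≤ κ−1 and (Eκ)) if and only if `λ (1 + φ + ⋯ + φ^{κ−1}) > 1`. -/
theorem irp_mean_field_nontrivial_iff (κ : ℕ) (hκ : 2 ≤ κ) (lam φ : ℝ)
    (hlam : 0 < lam) (hφ : 0 ≤ φ) :
    (∃ u : ℕ → ℝ,
      (∀ i ≤ κ, 0 ≤ u i) ∧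
      (∑ i ∈ Finset.range (κ + 1), u i = 1) ∧
      (∃ j, 1 ≤ j ∧ j ≤ κ ∧ 0 < u j) ∧
      (u 1 - lam * u 0 * ∑ i ∈ Finset.Icc 1 κ, (i : ℝ) * u i = 0) ∧
      (lam * u 0 * (∑ i ∈ Finset.Icc 1 κ, (i : ℝ) * u i) - (1 + φ) * u 1 + 2 * u 2 = 0) ∧
      (∀ i, 2 ≤ i → i ≤ κ - 1 →
        ((i : ℝ) - 1) * φ * u (i - 1) - (i : ℝ) * (1 + φ) * u i + ((i : ℝ) + 1) * u (i + 1) = 0) ∧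
      (((κ : ℝ) - 1) * φ * u (κ - 1) - (κ : ℝ) * u κ = 0)) ↔
    1 < lam * ∑ i ∈ Finset.range κ, φ ^ i := by
  have hS : 0 < ∑ i ∈ Finset.range κ, φ ^ i := by
    apply Finset.sum_pos' (fun i _ => by positivity)
    exact ⟨0, by simp; omega, by simp⟩
  constructor
  · rintro ⟨u, hu, hsum, ⟨j, hj1, hj2, hj⟩, h0, h1, hi, -⟩
    have key : ∀ i, i + 1 < κ → ((i : ℝ) + 2) * u (i + 2) = φ * (((i : ℝ) + 1) * u (i + 1)) := by
      intro i
      induction i with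
      | zero => intro _; norm_num; linarith
      | succ k ih =>
        intro hk
        have a := ih (by omega)
        have b := hi (k + 2) (by omega) (by omega)
        have e : k + 2 - 1 = k + 1 := by omega
        rw [e] at b
        push_cast at b ⊢
        linarith
    have form : ∀ i, i < κ → ((i + 1 : ℕ) : ℝ) * u (i + 1) = φ ^ i * u 1 := by
      intro i
      induction i with
      | zero => intro _; simp
      | succ k ih =>
        intro hk
        have a := ih (by omega)
        have b := key k hk
        push_cast at a ⊢
        rw [a] at b
        rw [pow_succ]
        linarith
    have hsumS : ∑ i ∈ Finset.Icc 1 κ, (i : ℝ) * u i = (∑ i ∈ Finset.range κ, φ ^ i) * u 1 := by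
      rw [irp_sum_shift (fun i => (i : ℝ) * u i), Finset.sum_mul]
      exact Finset.sum_congr rfl fun i h => form i (Finset.mem_range.1 h)
    have hu1 : u 1 ≠ 0 := by
      intro h
      have a := form (j - 1) (by omega)
      rw [h, Nat.sub_add_cancel hj1, mul_zero] at a
      have : (0 : ℝ) < j := by exact_mod_cast hj1
      have := mul_pos this hj
      linarith
    rw [hsumS] at h0
    have hE : lam * u 0 * (∑ i ∈ Finset.range κ, φ ^ i) = 1 := by
      apply mul_right_cancel₀ hu1
      linarith
    have hlt : u 0 < 1 := by
      rw [Finset.sum_range_succ'] at hsum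
      have : 0 < ∑ i ∈ Finset.range κ, u (i + 1) := by
        apply Finset.sum_pos' (fun i h => hu _ (by have := Finset.mem_range.1 h; omega))
        exact ⟨j - 1, by simp; omega, by rwa [Nat.sub_add_cancel hj1]⟩
      linarith
    have := mul_pos hlam hS
    nlinarith
  · intro h
    set S := ∑ i ∈ Finset.range κ, φ ^ i with hSd
    have hT : 0 < ∑ i ∈ Finset.range κ, φ ^ i / ((i : ℝ) + 1) := by
      apply Finset.sum_pos' (fun i _ => by positivity)
      exact ⟨0, by simp; omega, by simp⟩
    set T := ∑ i ∈ Finset.range κ, φ ^ i / ((i : ℝ) + 1) with hTd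
    have hlS : 0 < lam * S := mul_pos hlam hS
    have hlt : 1 / (lam * S) < 1 := by rw [div_lt_one hlS]; exact h
    obtain ⟨c, hc⟩ : ∃ c, c = (1 - 1 / (lam * S)) / T := ⟨_, rfl⟩
    have hc0 : 0 < c := by rw [hc]; exact div_pos (by linarith) hT
    have hcT : c * T = 1 - 1 / (lam * S) := by rw [hc]; field_simp
    let u : ℕ → ℝ := fun n => Nat.casesOn n (1 / (lam * S)) (fun i => c * (φ ^ i / ((i : ℝ) + 1)))
    have u0 : u 0 = 1 / (lam * S) := rfl
    have us : ∀ i, u (i + 1) = c * (φ ^ i / ((i : ℝ) + 1)) := fun i => rfl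
    have us' : ∀ i : ℕ, ((i : ℝ) + 1) * u (i + 1) = c * φ ^ i := by
      intro i
      rw [us]
      have : (i : ℝ) + 1 ≠ 0 := by positivity
      field_simp
    have u1 : u 1 = c := by simpa using us' 0
    have u2 : 2 * u 2 = c * φ := by
      have := us' 1
      norm_num at this
      exact this
    have hsumS : ∑ i ∈ Finset.Icc 1 κ, (i : ℝ) * u i = c * S := by
      rw [irp_sum_shift (fun i => (i : ℝ) * u i), hSd, Finset.mul_sum]
      refine Finset.sum_congr rfl fun i _ => ?_
      have := us' i
      push_cast
      exact this
    have hE : lam * u 0 * (c * S) = c := by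
      rw [u0]; field_simp
    clear_value u
    refine ⟨u, ?_, ?_, ⟨1, le_refl _, by omega, by rw [u1]; exact hc0⟩, ?_, ?_, ?_, ?_⟩
    · intro i _
      cases i with
      | zero => rw [u0]; positivity
      | succ k => rw [us]; positivity
    · rw [Finset.sum_range_succ', u0, Finset.sum_congr rfl (fun i _ => us i), ← Finset.mul_sum,
        ← hTd, hcT]
      ring
    · rw [hsumS, hE, u1]; ring
    · rw [hsumS, hE, u1, u2]; ring
    · intro i hi _
      obtain ⟨k, rfl⟩ := Nat.exists_eq_add_of_le' hi
      have a := us' k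
      have b := us' (k + 1)
      have d := us' (k + 2)
      have e : k + 2 - 1 = k + 1 := by omega
      rw [e]
      push_cast at b d ⊢
      rw [pow_succ] at b d
      rw [pow_succ] at d
      linear_combination φ * a - (1 + φ) * b + d
    · obtain ⟨k, rfl⟩ := Nat.exists_eq_add_of_le' hκ
      have a := us' k
      have b := us' (k + 1)
      have e : k + 2 - 1 = k + 1 := by omega
      rw [e]
      push_cast at b ⊢
      rw [pow_succ] at b
      linear_combination φ * a - b
end

section
/- Let κ ≥ 2 be an integer, λ > 0 and φ ≥ 0 with λ (1 + φ + ⋯ + φ^{κ−1}) > 1. If nonnegative real numbers u_0, u_1, …, u_κ satisfy ∑_{i=0}^κ u_i = 1, u_j > 0 for some 1 ≤ j ≤ κ, and all the mean-field stationarity equations (E0), (E1), (Ei) for 2 ≤ i ≤ κ−1 and (Eκ), then necessarily u_0 = (λ ∑_{i=0}^{κ−1} φ^i)^{−1}, u_1 = (1 − u_0)/(∑_{i=1}^κ φ^{i−1}/i), and u_i = (φ^{i−1}/i) u_1 for 2 ≤ i ≤ κ; in particular the nontrivial stationary solution is unique. -/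
/-- Uniqueness of the nontrivial mean-field stationary solution of the IRP: under
condition (1), any nonnegative stationary solution summing to one with some infected
density positive is given by the explicit formulas for u_0, u_1 and u_i, 2 ≤ i ≤ κ. -/
theorem irp_mean_field_unique (κ : ℕ) (hκ : 2 ≤ κ) (lam φ : ℝ)
    (hlam : 0 < lam) (hφ : 0 ≤ φ)
    (hcond : 1 < lam * ∑ i ∈ Finset.range κ, φ ^ i)
    (u : ℕ → ℝ)
    (hnonneg : ∀ i ≤ κ, 0 ≤ u i)
    (hsum : ∑ i ∈ Finset.range (κ + 1), u i = 1)
    (hpos : ∃ j, 1 ≤ j ∧ j ≤ κ ∧ 0 < u j)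
    (hE0 : u 1 - lam * u 0 * ∑ i ∈ Finset.Icc 1 κ, (i : ℝ) * u i = 0)
    (hE1 : lam * u 0 * (∑ i ∈ Finset.Icc 1 κ, (i : ℝ) * u i) - (1 + φ) * u 1 + 2 * u 2 = 0)
    (hEi : ∀ i, 2 ≤ i → i ≤ κ - 1 →
      ((i : ℝ) - 1) * φ * u (i - 1) - (i : ℝ) * (1 + φ) * u i + ((i : ℝ) + 1) * u (i + 1) = 0)
    (hEκ : ((κ : ℝ) - 1) * φ * u (κ - 1) - (κ : ℝ) * u κ = 0) :
    u 0 = (lam * ∑ i ∈ Finset.range κ, φ ^ i)⁻¹ ∧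
      u 1 = (1 - u 0) / (∑ i ∈ Finset.Icc 1 κ, φ ^ (i - 1) / (i : ℝ)) ∧
      ∀ i, 2 ≤ i → i ≤ κ → u i = φ ^ (i - 1) / (i : ℝ) * u 1 := by
  have step : ∀ n : ℕ, n + 2 ≤ κ → ((n : ℝ) + 2) * u (n + 2) = φ * (((n : ℝ) + 1) * u (n + 1)) := by
    intro n
    induction n with
    | zero => intro _; norm_num; linarith
    | succ n ih =>
      intro h
      have h1 := ih (by omega)
      have h2 := hEi (n + 2) (by omega) (by omega)
      have e : n + 2 - 1 = n + 1 := by omega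
      rw [e] at h2
      push_cast at h2 ⊢
      have e2 : n + 1 + 2 = n + 2 + 1 := by omega
      have e3 : n + 1 + 1 = n + 2 := by omega
      rw [e2, e3]
      linarith
  have key : ∀ n : ℕ, n + 1 ≤ κ → ((n : ℝ) + 1) * u (n + 1) = φ ^ n * u 1 := by
    intro n
    induction n with
    | zero => intro _; norm_num
    | succ n ih =>
      intro h
      have h1 := ih (by omega)
      have h2 := step n h
      rw [h1] at h2
      push_cast
      rw [pow_succ]
      have e3 : n + 1 + 1 = n + 2 := by omega
      rw [e3]
      linarith
  have form : ∀ n : ℕ, n + 1 ≤ κ → u (n + 1) = φ ^ n / ((n : ℝ) + 1) * u 1 := by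
    intro n h
    have := key n h
    have hp : (0 : ℝ) < (n : ℝ) + 1 := by positivity
    field_simp
    linarith
  have shift : ∀ f : ℕ → ℝ, ∑ i ∈ Finset.Icc 1 κ, f i = ∑ i ∈ Finset.range κ, f (i + 1) := by
    intro f
    rw [Finset.range_eq_Ico, Finset.sum_Ico_add' f 0 κ 1]
    rfl
  have hu1 : 0 < u 1 := by
    obtain ⟨j, hj1, hj, hj0⟩ := hpos
    obtain ⟨n, rfl⟩ : ∃ n, j = n + 1 := ⟨j - 1, by omega⟩
    rcases (hnonneg 1 (by omega)).lt_or_eq with h | h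
    · exact h
    · rw [form n hj, ← h] at hj0
      simp at hj0
  have hS : ∑ i ∈ Finset.Icc 1 κ, (i : ℝ) * u i = (∑ i ∈ Finset.range κ, φ ^ i) * u 1 := by
    rw [shift, Finset.sum_mul]
    refine Finset.sum_congr rfl fun i hi => ?_
    have := key i (Finset.mem_range.1 hi)
    push_cast
    exact this
  have hT : ∑ i ∈ Finset.range κ, u (i + 1)
      = (∑ i ∈ Finset.Icc 1 κ, φ ^ (i - 1) / (i : ℝ)) * u 1 := by
    rw [shift, Finset.sum_mul]
    refine Finset.sum_congr rfl fun i hi => ?_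
    have := form i (Finset.mem_range.1 hi)
    push_cast
    exact this
  rw [Finset.sum_range_succ', hT] at hsum
  have hTpos : 0 < ∑ i ∈ Finset.Icc 1 κ, φ ^ (i - 1) / (i : ℝ) := by
    refine Finset.sum_pos' (fun i _ => by positivity) ⟨1, ?_, by simp⟩
    simp
    omega
  refine ⟨?_, ?_, ?_⟩
  · rw [hS] at hE0
    apply eq_inv_of_mul_eq_one_left
    have h : u 1 * (u 0 * (lam * ∑ i ∈ Finset.range κ, φ ^ i)) = u 1 * 1 := by linarith
    exact mul_left_cancel₀ hu1.ne' h
  · rw [eq_div_iff hTpos.ne']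
    linarith
  · intro i h2 hi
    obtain ⟨n, rfl⟩ : ∃ n, i = n + 1 := ⟨i - 1, by omega⟩
    have := form n hi
    push_cast
    exact this
end

section
/- Let κ ≥ 2 be an integer and φ > 1. Consider the Markov chain (X_n)_{n≥0} on {0, 1, …, κ} with transition probabilities: from state i with 1 ≤ i ≤ κ−1 move to i+1 with probability φ/(1+φ) and to i−1 with probability 1/(1+φ); from state κ move to κ−1 with probability 1; state 0 is absorbing. Let P^κ denote the law of the trajectory of the chain started at κ (the Ionescu–Tulcea measure associated with this Markov kernel). Then for every integer N ≥ 1, P^κ(∃ n ≤ N, X_n = 0) ≤ N·φ^{1−κ}. -/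
open MeasureTheory ProbabilityTheory

/-- Transition probabilities of the birth–death chain on `{0, 1, …, κ}` of Lemma 4.2:
in the interior it moves up with probability `φ/(1+φ)` and down with probability
`1/(1+φ)`, from the ceiling `κ` it moves down with probability 1, and 0 is absorbing. -/
noncomputable def clusterChainKernel (κ : ℕ) (φ : ℝ) (i j : ℕ) : ℝ :=
  if i = 0 then (if j = 0 then 1 else 0)
  else if i = κ then (if j = κ - 1 then 1 else 0)
  else if j = i + 1 then φ / (1 + φ)
  else if j = i - 1 then 1 / (1 + φ)
  else 0

theorem cc_joint {Ω : Type*} [MeasurableSpace Ω] (P : Measure Ω)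
    (κ : ℕ) (φ : ℝ)
    (X : ℕ → Ω → ℕ) (hmeas : ∀ n, Measurable (X n))
    (hmarkov : ∀ (n : ℕ) (x : ℕ → ℕ),
      P (⋂ i ∈ Finset.range (n + 2), {ω | X i ω = x i}) =
        ENNReal.ofReal (clusterChainKernel κ φ (x n) (x (n + 1))) *
          P (⋂ i ∈ Finset.range (n + 1), {ω | X i ω = x i}))
    (n i j : ℕ) :
    P ({ω | X n ω = i} ∩ {ω | X (n+1) ω = j}) =
      ENNReal.ofReal (clusterChainKernel κ φ i j) * P {ω | X n ω = i} := by
  let f : Ω → (Fin n → ℕ) := fun ω k => X k ω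
  have hf : Measurable f := measurable_pi_lambda _ (fun k => hmeas k)
  have hdec : ∀ s : Set Ω, P s = ∑' y : Fin n → ℕ, P (f ⁻¹' {y} ∩ s) := by
    intro s
    have h := tsum_measure_preimage_singleton (μ := P.restrict s) (f := f)
      (Set.countable_univ) (fun y _ => hf (measurableSet_singleton y))
    rw [tsum_univ (fun y => (P.restrict s) (f ⁻¹' {y}))] at h
    simp only [Set.preimage_univ, Measure.restrict_apply_univ] at h
    rw [← h]
    refine tsum_congr fun y => ?_
    rw [Measure.restrict_apply (hf (measurableSet_singleton y))]
  rw [hdec, hdec {ω | X n ω = i}, ← ENNReal.tsum_mul_left]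
  refine tsum_congr fun y => ?_
  let x : ℕ → ℕ := fun k => if h : k < n then y ⟨k, h⟩ else if k = n then i else j
  have hxn : x n = i := by simp [x]
  have hxn1 : x (n+1) = j := by simp [x]
  have hxl : ∀ k (h : k < n), x k = y ⟨k, h⟩ := fun k h => by simp [x, h]
  have h1 : (⋂ k ∈ Finset.range (n + 1), {ω | X k ω = x k}) = f ⁻¹' {y} ∩ {ω | X n ω = i} := by
    ext ω
    simp only [Set.mem_iInter, Finset.mem_range, Set.mem_ofPred_eq, Set.mem_inter_iff,
      Set.mem_preimage, Set.mem_singleton_iff]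
    constructor
    · intro h
      refine ⟨?_, by rw [← hxn]; exact h n (by omega)⟩
      funext k
      rw [← hxl k k.2]; exact h k (by omega)
    · rintro ⟨h, h'⟩ k hk
      rcases Nat.lt_succ_iff_lt_or_eq.1 hk with hk | rfl
      · rw [hxl k hk, ← h]
      · rw [hxn, h']
  have h2 : (⋂ k ∈ Finset.range (n + 2), {ω | X k ω = x k}) =
      f ⁻¹' {y} ∩ ({ω | X n ω = i} ∩ {ω | X (n+1) ω = j}) := by
    rw [Finset.range_add_one, Finset.set_biInter_insert, h1, hxn1, Set.inter_comm, Set.inter_assoc]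
  rw [← h1, ← h2, hmarkov, hxn, hxn1]

theorem cc_nonneg (κ : ℕ) (φ : ℝ) (hφ : 1 < φ) (i j : ℕ) : 0 ≤ clusterChainKernel κ φ i j := by
  unfold clusterChainKernel
  split_ifs <;> positivity

theorem cc_drift (κ : ℕ) (hκ : 2 ≤ κ) (φ : ℝ) (hφ : 1 < φ) (i : ℕ) (hi : i ≤ κ) :
    ∑ j ∈ Finset.range (κ+1), clusterChainKernel κ φ i j * φ⁻¹ ^ j ≤
      φ⁻¹ ^ i + (φ⁻¹ ^ (κ-1) - φ⁻¹ ^ κ) := by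
  have hd : φ⁻¹ ^ κ ≤ φ⁻¹ ^ (κ-1) :=
    pow_le_pow_of_le_one (by positivity) (inv_le_one_of_one_le₀ hφ.le) (by omega)
  unfold clusterChainKernel
  by_cases h0 : i = 0
  · simp only [inv_pow] at hd
    simp [h0]; linarith
  by_cases h1 : i = κ
  · have : κ ≠ 0 := by omega
    simp [h1, this]
  obtain ⟨m, rfl⟩ : ∃ m, i = m + 1 := ⟨i-1, by omega⟩
  have key : ∀ j, (if m + 1 = 0 then (if j = 0 then 1 else 0)
      else if m + 1 = κ then (if j = κ - 1 then 1 else 0)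
      else if j = m + 1 + 1 then φ / (1 + φ)
      else if j = m + 1 - 1 then 1 / (1 + φ)
      else 0) * φ⁻¹ ^ j = (if j = m + 2 then φ / (1 + φ) * φ⁻¹ ^ (m+2) else 0) +
        (if j = m then 1 / (1 + φ) * φ⁻¹ ^ m else 0) := by
    intro j
    rw [if_neg h0, if_neg h1]
    by_cases ha : j = m + 2
    · subst ha; simp
    · by_cases hb : j = m
      · subst hb; simp; omega
      · simp [ha, hb]
  rw [Finset.sum_congr rfl (fun j _ => key j), Finset.sum_add_distrib, Finset.sum_ite_eq',
    Finset.sum_ite_eq', if_pos (by simp; omega), if_pos (by simp; omega)]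
  have : φ / (1 + φ) * φ⁻¹ ^ (m+2) + 1 / (1 + φ) * φ⁻¹ ^ m = φ⁻¹ ^ (m+1) := by
    have : φ ≠ 0 := by positivity
    have : 1 + φ ≠ 0 := by positivity
    rw [pow_succ, pow_succ]
    field_simp
  linarith

/-- Lemma 4.2 (discrete-time content): for the birth–death chain on `{0, …, κ}` with
up-probability `φ/(1+φ)` (`φ > 1`), down-probability `1/(1+φ)`, deterministic step down
from `κ` and absorption at 0, started at `κ`, the probability of hitting 0 within `N`
steps is at most `N φ^{1−κ}`. Here the law of the trajectory is characterized by its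
initial distribution and the Markov cylinder recursion. -/
theorem cluster_chain_ruin_bound {Ω : Type*} [MeasurableSpace Ω] (P : Measure Ω)
    [IsProbabilityMeasure P] (κ : ℕ) (hκ : 2 ≤ κ) (φ : ℝ) (hφ : 1 < φ)
    (X : ℕ → Ω → ℕ) (hmeas : ∀ n, Measurable (X n))
    (hrange : ∀ n ω, X n ω ≤ κ)
    (hinit : P {ω | X 0 ω = κ} = 1)
    (hmarkov : ∀ (n : ℕ) (x : ℕ → ℕ),
      P (⋂ i ∈ Finset.range (n + 2), {ω | X i ω = x i}) =
        ENNReal.ofReal (clusterChainKernel κ φ (x n) (x (n + 1))) *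
          P (⋂ i ∈ Finset.range (n + 1), {ω | X i ω = x i}))
    (N : ℕ) (hN : 1 ≤ N) :
    P {ω | ∃ n ≤ N, X n ω = 0} ≤ ENNReal.ofReal ((N : ℝ) * φ ^ (1 - (κ : ℤ))) := by
  have hJ := cc_joint P κ φ X hmeas hmarkov
  have hms : ∀ n i, MeasurableSet {ω | X n ω = i} := fun n i => hmeas n (measurableSet_singleton i)
  -- absorption
  have habs : ∀ᵐ ω ∂P, ∀ n, X n ω = 0 → X (n+1) ω = 0 := by
    rw [ae_all_iff]
    intro n
    have : ∀ᵐ ω ∂P, ∀ j, ¬ (j ≠ 0 ∧ X n ω = 0 ∧ X (n+1) ω = j) := by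
      rw [ae_all_iff]
      intro j
      by_cases hj : j = 0
      · simp [hj]
      · have h := hJ n 0 j
        rw [show clusterChainKernel κ φ 0 j = 0 by simp [clusterChainKernel, hj]] at h
        simp only [ENNReal.ofReal_zero, zero_mul] at h
        rw [ae_iff]
        refine measure_mono_null ?_ h
        intro ω hω
        simp only [Set.mem_ofPred_eq, not_not] at hω
        exact hω.2
    filter_upwards [this] with ω h h0
    by_contra hne
    exact h _ ⟨hne, h0, rfl⟩
  have hle : P {ω | ∃ n ≤ N, X n ω = 0} ≤ P {ω | X N ω = 0} := by
    apply measure_mono_ae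
    filter_upwards [habs] with ω h
    rintro ⟨n, hn, h0⟩
    exact Nat.le_induction (P := fun m _ => X m ω = 0) h0 (fun m _ hm => h m hm) N hn
  refine hle.trans ?_
  let p : ℕ → ℕ → ℝ := fun n i => P.real {ω | X n ω = i}
  have hp0 : ∀ n i, 0 ≤ p n i := fun n i => measureReal_nonneg
  have hdec : ∀ n (s : Set Ω), MeasurableSet s →
      P.real s = ∑ i ∈ Finset.range (κ+1), P.real ({ω | X n ω = i} ∩ s) := by
    intro n s hs
    rw [← measureReal_biUnion_finset]
    · congr 1
      ext ω
      have := hrange n ω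
      simp; omega
    · intro a _ b _ hab
      refine Set.disjoint_left.2 ?_
      rintro ω ⟨h1, _⟩ ⟨h2, _⟩
      exact hab (h1.symm.trans h2)
    · exact fun i _ => (hms n i).inter hs
  have hp1 : ∀ n, ∑ i ∈ Finset.range (κ+1), p n i = 1 := by
    intro n
    have := hdec n Set.univ MeasurableSet.univ
    simpa [p] using this.symm
  have hstep : ∀ n j, p (n+1) j =
      ∑ i ∈ Finset.range (κ+1), clusterChainKernel κ φ i j * p n i := by
    intro n j
    refine (hdec n _ (hms (n+1) j)).trans (Finset.sum_congr rfl fun i _ => ?_)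
    rw [measureReal_def, hJ, ENNReal.toReal_mul, ENNReal.toReal_ofReal (cc_nonneg κ φ hφ i j)]
    rfl
  let d : ℝ := φ⁻¹ ^ (κ-1) - φ⁻¹ ^ κ
  have hE : ∀ n : ℕ, ∑ j ∈ Finset.range (κ+1), p n j * φ⁻¹ ^ j ≤ φ⁻¹ ^ κ + n * d := by
    intro n
    induction n with
    | zero =>
      have hk : p 0 κ = 1 := by simp [p, measureReal_def, hinit]
      have hs := hp1 0
      rw [Finset.sum_range_succ, hk] at hs
      have hz : ∀ i ∈ Finset.range κ, p 0 i = 0 :=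
        (Finset.sum_eq_zero_iff_of_nonneg (fun i _ => hp0 0 i)).1 (by linarith)
      rw [Finset.sum_range_succ, hk, Finset.sum_eq_zero (fun i hi => by rw [hz i hi, zero_mul])]
      simp
    | succ n ih =>
      calc ∑ j ∈ Finset.range (κ+1), p (n+1) j * φ⁻¹ ^ j
          = ∑ i ∈ Finset.range (κ+1), p n i *
            ∑ j ∈ Finset.range (κ+1), clusterChainKernel κ φ i j * φ⁻¹ ^ j := by
            simp_rw [hstep, Finset.sum_mul, Finset.mul_sum]
            rw [Finset.sum_comm]
            refine Finset.sum_congr rfl fun i _ => Finset.sum_congr rfl fun j _ => by ring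
        _ ≤ ∑ i ∈ Finset.range (κ+1), p n i * (φ⁻¹ ^ i + d) := by
            refine Finset.sum_le_sum fun i hi => mul_le_mul_of_nonneg_left ?_ (hp0 n i)
            exact cc_drift κ hκ φ hφ i (by simp at hi; omega)
        _ = ∑ i ∈ Finset.range (κ+1), p n i * φ⁻¹ ^ i + d := by
            simp_rw [mul_add]
            rw [Finset.sum_add_distrib, ← Finset.sum_mul, hp1, one_mul]
        _ ≤ _ := by push_cast; linarith
  have hfin : p N 0 ≤ (N : ℝ) * φ ^ (1 - (κ : ℤ)) := by
    have hpow : φ ^ (1 - (κ : ℤ)) = φ⁻¹ ^ (κ-1) := by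
      rw [show (1 - (κ : ℤ)) = -((κ - 1 : ℕ) : ℤ) by omega, zpow_neg, zpow_natCast, inv_pow]
    have h1 : p N 0 ≤ ∑ j ∈ Finset.range (κ+1), p N j * φ⁻¹ ^ j := by
      have := Finset.single_le_sum (f := fun j => p N j * φ⁻¹ ^ j)
        (s := Finset.range (κ+1)) (fun j _ => mul_nonneg (hp0 N j) (by positivity))
        (Finset.mem_range.2 (Nat.succ_pos κ))
      simpa using this
    have h2 := hE N
    have hN' : (1:ℝ) ≤ N := by exact_mod_cast hN
    have h3 : (0:ℝ) ≤ φ⁻¹ ^ κ := by positivity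
    have h4 : φ⁻¹ ^ κ ≤ N * φ⁻¹ ^ κ := by nlinarith
    have h5 : (N:ℝ) * d = N * φ⁻¹ ^ (κ-1) - N * φ⁻¹ ^ κ := by simp only [d]; ring
    rw [hpow]
    linarith
  rw [← ofReal_measureReal]
  exact ENNReal.ofReal_le_ofReal hfin
end
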